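/- arXiv:2310.02010 — 14 statements merged into one kernel-verified Lean document; each statement's English description precedes it below -/
import Mathlib

section
/- For every f ∈ C_c(X)_F, the intersection of all maximal ideals of C_c(X)_F that contain f equals {g ∈ C_c(X)_F : Z(f) ⊆ Z(g)}. -/
/-- The ring `C_c(X)_F` of real valued functions on `X` with countable range whose
set of points of discontinuity is finite, as a subring of `X → ℝ`. -/
def CcF (X : Type*) [TopologicalSpace X] : Subring (X → ℝ) where
  carrier := {f : X → ℝ | (Set.range f).Countable ∧ {x : X | ¬ ContinuousAt f x}.Finite}
  zero_mem' :=
    ⟨(Set.countable_singleton (0 : ℝ)).mono (Set.range_subset_iff.mpr fun _ => Set.mem_singleton _),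
      Set.finite_empty.subset fun x hx => (hx continuousAt_const).elim⟩
  one_mem' :=
    ⟨(Set.countable_singleton (1 : ℝ)).mono (Set.range_subset_iff.mpr fun _ => Set.mem_singleton _),
      Set.finite_empty.subset fun x hx => (hx continuousAt_const).elim⟩
  add_mem' := fun {f g} hf hg =>
    ⟨(Set.Countable.image2 hf.1 hg.1 (· + ·)).mono
        (by rintro - ⟨x, rfl⟩
            exact Set.mem_image2_of_mem (Set.mem_range_self x) (Set.mem_range_self x)),
      (hf.2.union hg.2).subset (by
        intro x hx
        by_contra h
        simp only [Set.mem_union, Set.mem_setOf_eq, not_or, not_not] at h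
        exact hx (h.1.add h.2))⟩
  neg_mem' := fun {f} hf =>
    ⟨(hf.1.image (fun t => -t)).mono
        (by rintro - ⟨x, rfl⟩; exact ⟨f x, Set.mem_range_self x, rfl⟩),
      hf.2.subset (by
        intro x hx
        by_contra h
        simp only [Set.mem_setOf_eq, not_not] at h
        exact hx h.neg)⟩
  mul_mem' := fun {f g} hf hg =>
    ⟨(Set.Countable.image2 hf.1 hg.1 (· * ·)).mono
        (by rintro - ⟨x, rfl⟩
            exact Set.mem_image2_of_mem (Set.mem_range_self x) (Set.mem_range_self x)),
      (hf.2.union hg.2).subset (by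
        intro x hx
        by_contra h
        simp only [Set.mem_union, Set.mem_setOf_eq, not_or, not_not] at h
        exact hx (h.1.mul h.2))⟩

/-- The zero set `Z(f)` of `f ∈ C_c(X)_F`. -/
def zSet {X : Type*} [TopologicalSpace X] (f : CcF X) : Set X := {x : X | (f : X → ℝ) x = 0}

/-- Two subsets `A`, `B` of `X` are `F_c`-completely separated if some `f ∈ C_c(X)_F`
is `0` on `A` and `1` on `B`. -/
def FcCompletelySeparated (X : Type*) [TopologicalSpace X] (A B : Set X) : Prop :=
  ∃ f : CcF X, (∀ a ∈ A, (f : X → ℝ) a = 0) ∧ (∀ b ∈ B, (f : X → ℝ) b = 1)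

namespace CcF

variable {X : Type*} [TopologicalSpace X]

/-- Constant functions belong to `C_c(X)_F`. -/
theorem const_mem (c : ℝ) : (fun _ : X => c) ∈ CcF X :=
  ⟨(Set.countable_singleton c).mono (Set.range_subset_iff.mpr fun _ => Set.mem_singleton _),
    Set.finite_empty.subset fun _ hx => (hx continuousAt_const).elim⟩

/-- Evaluation at a point, as a ring homomorphism. -/
def evalHom (x : X) : CcF X →+* ℝ := (Pi.evalRingHom (fun _ : X => ℝ) x).comp (CcF X).subtype

theorem evalHom_surjective (x : X) : Function.Surjective (evalHom x) :=
  fun c => ⟨⟨fun _ => c, const_mem c⟩, rfl⟩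

/-- A nowhere vanishing element of `C_c(X)_F` is a unit. -/
theorem isUnit_of_forall_ne_zero {f : CcF X} (hf : ∀ x, (f : X → ℝ) x ≠ 0) : IsUnit f := by
  have hinv : (fun x => ((f : X → ℝ) x)⁻¹) ∈ CcF X := by
    refine ⟨(f.2.1.image (fun t => t⁻¹)).mono ?_, f.2.2.subset fun x hx hc => ?_⟩
    · rintro - ⟨x, rfl⟩
      exact ⟨_, Set.mem_range_self x, rfl⟩
    · exact hx (hc.inv₀ (hf x))
  refine IsUnit.of_mul_eq_one ⟨_, hinv⟩ (Subtype.ext (funext fun x => ?_))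
  exact mul_inv_cancel₀ (hf x)

/-- A maximal ideal containing `f` contains every `g` with `Z(f) ⊆ Z(g)`. -/
theorem mem_of_zSet_subset {M : Ideal (CcF X)} (hM : M.IsMaximal) {f g : CcF X} (hf : f ∈ M)
    (hfg : zSet f ⊆ zSet g) : g ∈ M := by
  by_contra hg
  obtain ⟨h, m, hm, e⟩ := hM.exists_inv hg
  have hmem : f * f + m * m ∈ M := M.add_mem (M.mul_mem_left _ hf) (M.mul_mem_left _ hm)
  refine hM.ne_top (M.eq_top_of_isUnit_mem hmem (isUnit_of_forall_ne_zero fun x hx => ?_))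
  have hx' : (f : X → ℝ) x * (f : X → ℝ) x + (m : X → ℝ) x * (m : X → ℝ) x = 0 := hx
  obtain ⟨hfx, hmx⟩ := mul_self_add_mul_self_eq_zero.mp hx'
  have hgx : (g : X → ℝ) x = 0 := hfg hfx
  have ex : (h : X → ℝ) x * (g : X → ℝ) x + (m : X → ℝ) x = 1 :=
    congrFun (congrArg Subtype.val e) x
  simp [hgx, hmx] at ex

end CcF

theorem stmt2 {X : Type*} [TopologicalSpace X] [T1Space X] (f : CcF X) :
    (⋂ M ∈ {M : Ideal (CcF X) | M.IsMaximal ∧ f ∈ M}, (M : Set (CcF X))) =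
      {g : CcF X | zSet f ⊆ zSet g} := by
  ext g
  simp only [Set.mem_iInter, Set.mem_ofPred_eq, SetLike.mem_coe]
  refine ⟨fun hg x hx => ?_, fun hfg M hM => CcF.mem_of_zSet_subset hM.1 hM.2 hfg⟩
  exact hg (RingHom.ker (CcF.evalHom x))
    ⟨RingHom.ker_isMaximal_of_surjective _ (CcF.evalHom_surjective x), hx⟩
end

section
/- Let I be a proper (Z_c)_F-ideal of C_c(X)_F. Then I is a prime ideal if and only if for all f, g ∈ C_c(X)_F with fg = 0 one has f ∈ I or g ∈ I. -/
/-- `C_c(X)_F` is closed under continuous binary operations on values. -/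
lemma CcF.comp₂_mem {X : Type*} [TopologicalSpace X] (φ : ℝ × ℝ → ℝ) (hφ : Continuous φ)
    (f g : CcF X) : (fun x => φ ((f : X → ℝ) x, (g : X → ℝ) x)) ∈ CcF X := by
  refine ⟨(Set.Countable.image2 f.2.1 g.2.1 fun s t => φ (s, t)).mono ?_,
    (f.2.2.union g.2.2).subset ?_⟩
  · rintro - ⟨x, rfl⟩
    exact Set.mem_image2_of_mem (Set.mem_range_self x) (Set.mem_range_self x)
  · intro x hx
    by_contra h
    simp only [Set.mem_union, Set.mem_ofPred_eq, not_or, not_not] at h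
    exact hx (hφ.continuousAt.comp (h.1.prodMk h.2))

/-- The positive part of `|f| - |g|`, as an element of `C_c(X)_F`. -/
noncomputable def CcF.absSubPos {X : Type*} [TopologicalSpace X] (f g : CcF X) : CcF X :=
  ⟨_, CcF.comp₂_mem (fun p => max (|p.1| - |p.2|) 0) (by fun_prop) f g⟩

lemma CcF.absSubPos_apply {X : Type*} [TopologicalSpace X] (f g : CcF X) (x : X) :
    (CcF.absSubPos f g : X → ℝ) x = max (|(f : X → ℝ) x| - |(g : X → ℝ) x|) 0 := rfl

lemma CcF.absSubPos_mul_absSubPos {X : Type*} [TopologicalSpace X] (f g : CcF X) :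
    CcF.absSubPos f g * CcF.absSubPos g f = 0 := by
  ext x
  change (CcF.absSubPos f g : X → ℝ) x * (CcF.absSubPos g f : X → ℝ) x = 0
  rw [CcF.absSubPos_apply, CcF.absSubPos_apply, mul_eq_zero]
  rcases le_total |(f : X → ℝ) x| |(g : X → ℝ) x| with h | h
  · exact Or.inl (max_eq_right (sub_nonpos.mpr h))
  · exact Or.inr (max_eq_right (sub_nonpos.mpr h))

/-- Where `|f| ≤ |g|` and `f * g = 0`, the function `f` vanishes. -/
lemma CcF.mem_of_absSubPos_mem {X : Type*} [TopologicalSpace X] {I : Ideal (CcF X)}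
    (hzc : ∀ f ∈ I, ∀ g : CcF X, zSet f ⊆ zSet g → g ∈ I) {f g : CcF X}
    (hfg : f * g ∈ I) (h : CcF.absSubPos f g ∈ I) : f ∈ I := by
  refine hzc _ (I.add_mem (I.mul_mem_left (CcF.absSubPos f g) h)
    (I.mul_mem_left (f * g) hfg)) f fun x hx => ?_
  change (CcF.absSubPos f g : X → ℝ) x * (CcF.absSubPos f g : X → ℝ) x +
    ((f : X → ℝ) x * (g : X → ℝ) x) * ((f : X → ℝ) x * (g : X → ℝ) x) = 0 at hx
  change (f : X → ℝ) x = 0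
  obtain ⟨h₁, h₂⟩ := mul_self_add_mul_self_eq_zero.mp hx
  rcases mul_eq_zero.mp h₂ with h₂ | h₂
  · exact h₂
  · rw [CcF.absSubPos_apply, h₂, abs_zero, sub_zero, max_eq_left (abs_nonneg _)] at h₁
    exact abs_eq_zero.mp h₁


theorem stmt3 {X : Type*} [TopologicalSpace X] [T1Space X] (I : Ideal (CcF X))
    (hproper : I ≠ ⊤)
    (hzc : ∀ f ∈ I, ∀ g : CcF X, zSet f ⊆ zSet g → g ∈ I) :
    I.IsPrime ↔ ∀ f g : CcF X, f * g = 0 → f ∈ I ∨ g ∈ I := by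
  refine ⟨fun hI f g hfg => hI.mem_or_mem (hfg ▸ I.zero_mem), fun H => ⟨hproper, ?_⟩⟩
  intro f g hfg
  exact (H _ _ (CcF.absSubPos_mul_absSubPos f g)).imp (CcF.mem_of_absSubPos_mem hzc hfg)
    (CcF.mem_of_absSubPos_mem hzc (mul_comm f g ▸ hfg))
end

section
/- C_c(X)_F is a Gelfand ring: every prime ideal of C_c(X)_F is contained in a unique maximal ideal; that is, if P is a prime ideal and M₁, M₂ are maximal ideals of C_c(X)_F with P ⊆ M₁ and P ⊆ M₂, then M₁ = M₂. -/
theorem CcF.comp_mem {X : Type*} [TopologicalSpace X] (f : CcF X) {φ : ℝ → ℝ}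
    (hφ : ∀ x, ContinuousAt φ ((f : X → ℝ) x)) : φ ∘ (f : X → ℝ) ∈ CcF X := by
  refine ⟨?_, f.2.2.subset fun x hx hf => hx ((hφ x).comp hf)⟩
  rw [Set.range_comp]
  exact f.2.1.image φ

theorem CcF.isUnit_of_forall_ne_zero_s4 {X : Type*} [TopologicalSpace X] (f : CcF X)
    (hf : ∀ x, (f : X → ℝ) x ≠ 0) : IsUnit f := by
  refine IsUnit.of_mul_eq_one ⟨_, CcF.comp_mem f fun x => continuousAt_inv₀ (hf x)⟩ ?_
  ext x
  exact mul_inv_cancel₀ (hf x)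

/-- The truncation `max 0 (1 - 2 |f|)`, whose cozero set is `{|f| < 1/2}`. -/
noncomputable def CcF.bump {X : Type*} [TopologicalSpace X] (f : CcF X) : CcF X :=
  ⟨(fun t => max 0 (1 - 2 * |t|)) ∘ (f : X → ℝ),
    CcF.comp_mem f fun _ => Continuous.continuousAt (by fun_prop)⟩

theorem CcF.bump_apply {X : Type*} [TopologicalSpace X] (f : CcF X) (x : X) :
    (CcF.bump f : X → ℝ) x = max 0 (1 - 2 * |(f : X → ℝ) x|) :=
  rfl

theorem CcF.bump_notMem {X : Type*} [TopologicalSpace X] {M : Ideal (CcF X)} (hM : M ≠ ⊤)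
    {f : CcF X} (hf : f ∈ M) : CcF.bump f ∉ M := by
  intro hb
  refine hM (Ideal.eq_top_of_isUnit_mem M (M.add_mem hb (M.mul_mem_left f hf))
    (CcF.isUnit_of_forall_ne_zero_s4 _ fun x => ne_of_gt ?_))
  change 0 < (CcF.bump f : X → ℝ) x + (f : X → ℝ) x * (f : X → ℝ) x
  rw [CcF.bump_apply]
  by_cases h : (f : X → ℝ) x = 0
  · simp [h]
  · exact add_pos_of_nonneg_of_pos (le_max_left _ _) (mul_self_pos.mpr h)

theorem CcF.bump_mul_bump {X : Type*} [TopologicalSpace X] {f g : CcF X} (h : f + g = 1) :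
    CcF.bump f * CcF.bump g = 0 := by
  ext x
  have hx : (f : X → ℝ) x + (g : X → ℝ) x = 1 := congrFun (congrArg Subtype.val h) x
  change (CcF.bump f : X → ℝ) x * (CcF.bump g : X → ℝ) x = 0
  rw [CcF.bump_apply, CcF.bump_apply, mul_eq_zero, max_eq_left_iff, max_eq_left_iff]
  by_contra! hlt
  linarith [le_abs_self ((f : X → ℝ) x), le_abs_self ((g : X → ℝ) x)]

theorem stmt4 {X : Type*} [TopologicalSpace X] [T1Space X] (P M₁ M₂ : Ideal (CcF X))
    (hP : P.IsPrime) (hM₁ : M₁.IsMaximal) (hM₂ : M₂.IsMaximal)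
    (h₁ : P ≤ M₁) (h₂ : P ≤ M₂) : M₁ = M₂ := by
  by_contra hne
  have hsup : M₁ ⊔ M₂ = ⊤ := hM₁.coprime_of_ne hM₂ hne
  obtain ⟨a, ha, b, hb, hab⟩ :=
    Submodule.mem_sup.mp ((Ideal.eq_top_iff_one _).mp hsup)
  have hmem : CcF.bump a * CcF.bump b ∈ P := CcF.bump_mul_bump hab ▸ P.zero_mem
  rcases hP.mem_or_mem hmem with h | h
  · exact CcF.bump_notMem hM₁.ne_top ha (h₁ h)
  · exact CcF.bump_notMem hM₂.ne_top hb (h₂ h)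
end

section
/- If I and J are (Z_c)_F-ideals of C_c(X)_F (i.e., each has the property that f in the ideal, g ∈ C_c(X)_F and Z(f) ⊆ Z(g) imply g is in the ideal), then the ideal I + J also has this property; in particular, the sum of two (Z_c)_F-ideals of C_c(X)_F is either all of C_c(X)_F or again a (Z_c)_F-ideal. -/
/-- If `g` vanishes on the common zeros of `a` and `b`, then `g * a² / (a² + b²)` is
continuous wherever `a`, `b` and `g` are. -/
theorem ContinuousAt.mul_sq_div_sq_add_sq {X : Type*} [TopologicalSpace X] {a b g : X → ℝ}
    (h : ∀ x, a x = 0 → b x = 0 → g x = 0) {x : X} (ha : ContinuousAt a x)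
    (hb : ContinuousAt b x) (hg : ContinuousAt g x) :
    ContinuousAt (fun y => g y * (a y ^ 2 / (a y ^ 2 + b y ^ 2))) x := by
  by_cases hx : a x ^ 2 + b x ^ 2 = 0
  · have hax : a x = 0 := by nlinarith [sq_nonneg (a x), sq_nonneg (b x)]
    have hbx : b x = 0 := by nlinarith [sq_nonneg (a x), sq_nonneg (b x)]
    have hgx : g x = 0 := h x hax hbx
    have hg' : Filter.Tendsto (fun y => ‖g y‖) (nhds x) (nhds 0) := by
      simpa [ContinuousAt, hgx] using hg.norm
    have key : Filter.Tendsto (fun y => g y * (a y ^ 2 / (a y ^ 2 + b y ^ 2)))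
        (nhds x) (nhds 0) := by
      refine squeeze_zero_norm (fun y => ?_) hg'
      rw [norm_mul]
      refine mul_le_of_le_one_right (norm_nonneg _) ?_
      rw [Real.norm_of_nonneg (by positivity)]
      exact div_le_one_of_le₀ (by nlinarith [sq_nonneg (b y)]) (by positivity)
    simpa [ContinuousAt, hgx] using key
  · exact hg.mul ((ha.pow 2).div ((ha.pow 2).add (hb.pow 2)) hx)

/-- If `g` vanishes on the common zeros of `a` and `b`, then `g * a² / (a² + b²)` belongs to
`C_c(X)_F`. -/
theorem CcF.mul_sq_div_sq_add_sq_mem {X : Type*} [TopologicalSpace X] (a b g : CcF X)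
    (h : zSet a ∩ zSet b ⊆ zSet g) :
    (fun x => (g : X → ℝ) x * ((a : X → ℝ) x ^ 2 / ((a : X → ℝ) x ^ 2 + (b : X → ℝ) x ^ 2)))
      ∈ CcF X := by
  refine ⟨?_, ?_⟩
  · refine (((g.2.1.prod (a.2.1.prod b.2.1)).image
      fun p : ℝ × ℝ × ℝ => p.1 * (p.2.1 ^ 2 / (p.2.1 ^ 2 + p.2.2 ^ 2)))).mono ?_
    rintro - ⟨x, rfl⟩
    exact ⟨⟨_, _, _⟩, ⟨Set.mem_range_self x, Set.mem_range_self x, Set.mem_range_self x⟩, rfl⟩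
  · refine (a.2.2.union (b.2.2.union g.2.2)).subset fun x hx => ?_
    by_contra hc
    simp only [Set.mem_union, Set.mem_ofPred_eq, not_or, not_not] at hc
    exact hx (ContinuousAt.mul_sq_div_sq_add_sq (fun y hay hby => h ⟨hay, hby⟩)
      hc.1 hc.2.1 hc.2.2)

theorem stmt5 {X : Type*} [TopologicalSpace X] [T1Space X] (I J : Ideal (CcF X))
    (hI : ∀ f ∈ I, ∀ g : CcF X, zSet f ⊆ zSet g → g ∈ I)
    (hJ : ∀ f ∈ J, ∀ g : CcF X, zSet f ⊆ zSet g → g ∈ J) :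
    ∀ f ∈ I + J, ∀ g : CcF X, zSet f ⊆ zSet g → g ∈ I + J := by
  intro f hf g hfg
  obtain ⟨a, ha, b, hb, rfl⟩ := Submodule.mem_sup.mp hf
  have hab : zSet a ∩ zSet b ⊆ zSet g := by
    rintro x ⟨hax, hbx⟩
    apply hfg
    change (a : X → ℝ) x + (b : X → ℝ) x = 0
    rw [show (a : X → ℝ) x = 0 from hax, show (b : X → ℝ) x = 0 from hbx, add_zero]
  let k : CcF X := ⟨_, CcF.mul_sq_div_sq_add_sq_mem a b g hab⟩
  refine Submodule.mem_sup.mpr ⟨k, hI a ha k ?_, g - k, hJ b hb (g - k) ?_, by abel⟩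
  · intro x hx
    change (g : X → ℝ) x * ((a : X → ℝ) x ^ 2 / ((a : X → ℝ) x ^ 2 + (b : X → ℝ) x ^ 2)) = 0
    rw [show (a : X → ℝ) x = 0 from hx]
    simp
  · intro x hx
    change (g : X → ℝ) x -
      (g : X → ℝ) x * ((a : X → ℝ) x ^ 2 / ((a : X → ℝ) x ^ 2 + (b : X → ℝ) x ^ 2)) = 0
    rw [show (b : X → ℝ) x = 0 from hx]
    by_cases hax : (a : X → ℝ) x = 0
    · rw [show (g : X → ℝ) x = 0 from hab ⟨hax, hx⟩]
      simp
    · field_simp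
      simp
end

section
/- X is a finite set if and only if every maximal ideal M of C_c(X)_F is fixed, i.e., there exists x ∈ X with f(x) = 0 for all f ∈ M. -/
open Classical in
theorem indicator_singleton_mem_CcF {X : Type*} [TopologicalSpace X] [T1Space X] (x : X) :
    (Pi.single x 1 : X → ℝ) ∈ CcF X := by
  refine ⟨((Set.toFinite {0, 1}).subset (t := Set.range (Pi.single x 1 : X → ℝ)) ?_).countable,
    (Set.finite_singleton x).subset ?_⟩
  · rintro - ⟨y, rfl⟩
    by_cases h : y = x
    · subst h; simp
    · simp [h]
  · intro y hy
    by_contra h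
    have h' : y ≠ x := h
    refine hy (ContinuousAt.congr (f := fun _ => (0 : ℝ)) continuousAt_const ?_)
    filter_upwards [isOpen_ne.mem_nhds h'] with z hz
    simp [Pi.single_eq_of_ne hz]

theorem mem_CcF_of_finite {X : Type*} [TopologicalSpace X] [Finite X] (f : X → ℝ) :
    f ∈ CcF X :=
  ⟨(Set.finite_range f).countable, Set.toFinite _⟩

/-- The ideal of functions in `C_c(X)_F` with finite cozero set. -/
def finiteCozeroIdeal (X : Type*) [TopologicalSpace X] : Ideal (CcF X) where
  carrier := {f : CcF X | {x : X | (f : X → ℝ) x ≠ 0}.Finite}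
  zero_mem' := by simp
  add_mem' := fun {f g} hf hg => (hf.union hg).subset fun x hx => by
    by_contra h
    simp only [Set.mem_union, Set.mem_ofPred_eq, not_or, not_not] at h
    exact hx (by simp [h.1, h.2])
  smul_mem' := fun g f hf => hf.subset fun x hx h => hx (by simp [h])

theorem finiteCozeroIdeal_ne_top (X : Type*) [TopologicalSpace X] [Infinite X] :
    finiteCozeroIdeal X ≠ ⊤ := by
  intro h
  have h1 : {x : X | ((1 : CcF X) : X → ℝ) x ≠ 0}.Finite :=
    (Ideal.eq_top_iff_one _).mp h
  exact Set.infinite_univ (by simpa using h1)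

theorem exists_forall_eq_zero_of_finite {X : Type*} [TopologicalSpace X] [Finite X]
    {M : Ideal (CcF X)} (hM : M ≠ ⊤) : ∃ x : X, ∀ f ∈ M, (f : X → ℝ) x = 0 := by
  by_contra! h
  choose f hfM hf using h
  have := Fintype.ofFinite X
  let g : CcF X := ∑ x, f x * f x
  have hgM : g ∈ M := M.sum_mem fun x _ => M.mul_mem_left _ (hfM x)
  have hg : ∀ y, (g : X → ℝ) y ≠ 0 := fun y => by
    have hsum : (g : X → ℝ) y = ∑ x, (f x : X → ℝ) y * (f x : X → ℝ) y := by
      simp [g, Finset.sum_apply]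
    rw [hsum]
    exact (Finset.sum_pos' (fun x _ => mul_self_nonneg ((f x : X → ℝ) y))
      ⟨y, Finset.mem_univ y, mul_self_pos.mpr (hf y)⟩).ne'
  refine hM ((Ideal.eq_top_iff_one _).mpr ?_)
  have hinv : (⟨(g : X → ℝ)⁻¹, mem_CcF_of_finite _⟩ : CcF X) * g = 1 := by
    ext y
    exact inv_mul_cancel₀ (hg y)
  exact hinv ▸ M.mul_mem_left _ hgM

theorem stmt6 {X : Type*} [TopologicalSpace X] [T1Space X] :
    Finite X ↔
      ∀ M : Ideal (CcF X), M.IsMaximal → ∃ x : X, ∀ f ∈ M, (f : X → ℝ) x = 0 := by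
  refine ⟨fun _ M hM => exists_forall_eq_zero_of_finite hM.ne_top, fun h => ?_⟩
  by_contra hX
  rw [not_finite_iff_infinite] at hX
  obtain ⟨M, hM, hle⟩ := Ideal.exists_le_maximal _ (finiteCozeroIdeal_ne_top X)
  obtain ⟨x, hx⟩ := h M hM
  classical
  have hmem : (⟨Pi.single x 1, indicator_singleton_mem_CcF x⟩ : CcF X) ∈ finiteCozeroIdeal X :=
    (Set.finite_singleton x).subset fun y hy => by
      by_contra hne
      exact hy (Pi.single_eq_of_ne hne _)
  have h0 : (Pi.single x 1 : X → ℝ) x = 0 := by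
    convert hx _ (hle hmem)
  simp at h0
end

section
/- For ideals I and J of C_c(X)_F, Ann(I) ⊆ Ann(J) if and only if ⋂_{f ∈ I} Z(f) ⊆ ⋂_{g ∈ J} Z(g), where Ann(K) = {h ∈ C_c(X)_F : hk = 0 for all k ∈ K}. -/
/-- The characteristic function of a point of a T₁ space, as an element of `C_c(X)_F`. -/
noncomputable def pointIndicator {X : Type*} [TopologicalSpace X] [T1Space X] (x : X) : CcF X :=
  ⟨Set.indicator {x} 1, by
    refine ⟨?_, (Set.finite_singleton x).subset fun y hy => ?_⟩
    · refine (Set.toFinite ({0, 1} : Set ℝ)).countable.mono ?_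
      rintro - ⟨y, rfl⟩
      by_cases h : y = x <;> simp [h]
    · by_contra hne
      refine hy (continuousAt_const (y := (0 : ℝ)) |>.congr ?_)
      filter_upwards [isOpen_compl_singleton.mem_nhds hne] with z hz
      exact (Set.indicator_of_notMem hz _).symm⟩

@[simp]
theorem pointIndicator_self {X : Type*} [TopologicalSpace X] [T1Space X] (x : X) :
    (pointIndicator x : X → ℝ) x = 1 := by
  simp [pointIndicator]

theorem pointIndicator_of_ne {X : Type*} [TopologicalSpace X] [T1Space X] {x y : X}
    (h : y ≠ x) : (pointIndicator x : X → ℝ) y = 0 := by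
  simp [pointIndicator, h]

theorem CcF.mul_eq_zero_iff {X : Type*} [TopologicalSpace X] {h k : CcF X} :
    h * k = 0 ↔ ∀ x, (h : X → ℝ) x = 0 ∨ (k : X → ℝ) x = 0 := by
  simp [Subtype.ext_iff, funext_iff]

theorem pointIndicator_mul_eq_zero_iff {X : Type*} [TopologicalSpace X] [T1Space X] {x : X}
    {k : CcF X} : pointIndicator x * k = 0 ↔ x ∈ zSet k := by
  rw [CcF.mul_eq_zero_iff]
  refine ⟨fun h => (h x).resolve_left (by simp), fun h y => ?_⟩
  by_cases hy : y = x
  · exact Or.inr (hy ▸ h)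
  · exact Or.inl (pointIndicator_of_ne hy)

theorem stmt7 {X : Type*} [TopologicalSpace X] [T1Space X] (I J : Ideal (CcF X)) :
    {h : CcF X | ∀ k ∈ I, h * k = 0} ⊆ {h : CcF X | ∀ k ∈ J, h * k = 0} ↔
      (⋂ f ∈ I, zSet f) ⊆ ⋂ g ∈ J, zSet g := by
  constructor
  · intro H x hx
    simp only [Set.mem_iInter, ← pointIndicator_mul_eq_zero_iff] at hx ⊢
    exact H hx
  · intro H h hh g hg
    refine CcF.mul_eq_zero_iff.mpr fun x => or_iff_not_imp_left.mpr fun hx => ?_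
    have hxI : x ∈ ⋂ f ∈ I, zSet f :=
      Set.mem_iInter₂.mpr fun k hk => (CcF.mul_eq_zero_iff.mp (hh k hk) x).resolve_left hx
    exact Set.mem_iInter₂.mp (H hxI) g hg
end

section
/- A nonzero ideal I of C_c(X)_F is an essential ideal if and only if I is free, i.e., if and only if ⋂_{f ∈ I} Z(f) = ∅. -/
/-- The characteristic function of a point, as an element of `CcF X`. -/
noncomputable def CcF.single {X : Type*} [TopologicalSpace X] [T1Space X] (x : X) : CcF X :=
  ⟨Set.indicator {x} 1, by
    refine ⟨(Set.toFinite ({0, 1} : Set ℝ)).countable.mono ?_,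
      (Set.finite_singleton x).subset fun y hy => ?_⟩
    · rintro - ⟨y, rfl⟩
      by_cases h : y ∈ ({x} : Set X) <;> simp [h]
    · by_contra h
      refine hy ((continuousAt_const (y := (0 : ℝ))).congr ?_)
      filter_upwards [isOpen_compl_singleton.mem_nhds h] with z hz
      exact (Set.indicator_of_notMem hz _).symm⟩

theorem CcF.single_apply_self {X : Type*} [TopologicalSpace X] [T1Space X] (x : X) :
    (CcF.single x : X → ℝ) x = 1 := by
  simp [CcF.single]

theorem CcF.single_apply_of_ne {X : Type*} [TopologicalSpace X] [T1Space X] {x y : X}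
    (h : y ≠ x) : (CcF.single x : X → ℝ) y = 0 := by
  simp [CcF.single, h]

theorem CcF.exists_mem_apply_ne_zero {X : Type*} [TopologicalSpace X] {J : Ideal (CcF X)}
    (hJ : J ≠ ⊥) : ∃ g ∈ J, ∃ x, (g : X → ℝ) x ≠ 0 := by
  obtain ⟨g, hg, hne⟩ := Submodule.exists_mem_ne_zero_of_ne_bot hJ
  exact ⟨g, hg, Function.ne_iff.mp fun h => hne (Subtype.ext h)⟩

theorem stmt8 {X : Type*} [TopologicalSpace X] [T1Space X] (I : Ideal (CcF X))
    (hI : I ≠ ⊥) :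
    (∀ J : Ideal (CcF X), J ≠ ⊥ → I ⊓ J ≠ ⊥) ↔ (⋂ f ∈ I, zSet f) = ∅ := by
  constructor
  · refine fun h => Set.eq_empty_iff_forall_notMem.mpr fun x hx => ?_
    have hne : Ideal.span {CcF.single x} ≠ ⊥ := by
      rw [Ne, Ideal.span_singleton_eq_bot]
      intro h0
      have h1 := CcF.single_apply_self x
      rw [h0] at h1
      exact zero_ne_one h1
    obtain ⟨g, hg, y, hy⟩ := CcF.exists_mem_apply_ne_zero (h _ hne)
    obtain ⟨a, rfl⟩ := Ideal.mem_span_singleton'.mp hg.2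
    by_cases hyx : y = x
    · subst hyx
      exact hy (Set.mem_iInter₂.mp hx _ hg.1)
    · exact hy (mul_eq_zero_of_right _ (CcF.single_apply_of_ne hyx))
  · intro h J hJ hbot
    obtain ⟨g, hg, y, hy⟩ := CcF.exists_mem_apply_ne_zero hJ
    have hmem : y ∉ ⋂ f ∈ I, zSet f := h ▸ Set.notMem_empty y
    simp only [Set.mem_iInter, not_forall] at hmem
    obtain ⟨f, hf, hfy⟩ := hmem
    have hfg : f * g ∈ I ⊓ J := ⟨I.mul_mem_right g hf, J.mul_mem_left f hg⟩
    rw [hbot, Ideal.mem_bot] at hfg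
    exact mul_ne_zero hfy hy (congrFun (congrArg Subtype.val hfg) y)
end

section
/- A nonzero ideal I of C_c(X)_F is a minimal ideal (i.e., the only ideal properly contained in I is the zero ideal) if and only if I is the principal ideal generated by χ_a for some a ∈ X. -/
open scoped Classical

/-- The characteristic function of a singleton `{a}`, as an element of `C_c(X)_F`. -/
noncomputable def chi (X : Type*) [TopologicalSpace X] [T1Space X] (a : X) : CcF X :=
  ⟨fun y => if y = a then (1 : ℝ) else 0, by
    constructor
    · refine ((Set.finite_singleton (1 : ℝ)).insert 0).countable.mono ?_
      rintro - ⟨x, rfl⟩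
      by_cases hx : x = a <;> simp [hx]
    · refine (Set.finite_singleton a).subset fun x hx => ?_
      by_contra hxa
      refine hx ?_
      have hev : (fun y => if y = a then (1 : ℝ) else 0) =ᶠ[nhds x] fun _ => (0 : ℝ) := by
        filter_upwards [isOpen_ne.mem_nhds hxa] with y hy
        simp [hy]
      exact hev.continuousAt⟩

theorem chi_apply_self {X : Type*} [TopologicalSpace X] [T1Space X] (a : X) :
    (chi X a : X → ℝ) a = 1 :=
  if_pos rfl

theorem chi_apply_of_ne {X : Type*} [TopologicalSpace X] [T1Space X] {a x : X} (h : x ≠ a) :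
    (chi X a : X → ℝ) x = 0 :=
  if_neg h

theorem chi_ne_zero {X : Type*} [TopologicalSpace X] [T1Space X] (a : X) : chi X a ≠ 0 := by
  intro h
  have h1 := chi_apply_self a
  rw [h] at h1
  exact zero_ne_one h1

theorem CcF.exists_apply_ne_zero {X : Type*} [TopologicalSpace X] {f : CcF X} (hf : f ≠ 0) :
    ∃ a, (f : X → ℝ) a ≠ 0 := by
  by_contra! h
  exact hf (Subtype.ext (funext h))

theorem CcF.const_mem_s10 (X : Type*) [TopologicalSpace X] (c : ℝ) : (fun _ => c) ∈ CcF X :=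
  ⟨(Set.countable_singleton c).mono (Set.range_subset_iff.mpr fun _ => Set.mem_singleton _),
    Set.finite_empty.subset fun _ hx => (hx continuousAt_const).elim⟩

/-- An ideal containing a function that does not vanish at `a` contains `chi X a`. -/
theorem chi_mem_of_apply_ne_zero {X : Type*} [TopologicalSpace X] [T1Space X]
    {I : Ideal (CcF X)} {f : CcF X} (hf : f ∈ I) {a : X} (ha : (f : X → ℝ) a ≠ 0) :
    chi X a ∈ I := by
  have key : chi X a = ⟨_, CcF.const_mem_s10 X ((f : X → ℝ) a)⁻¹⟩ * chi X a * f := by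
    refine Subtype.ext (funext fun x => ?_)
    change (chi X a : X → ℝ) x = ((f : X → ℝ) a)⁻¹ * (chi X a : X → ℝ) x * (f : X → ℝ) x
    rcases eq_or_ne x a with rfl | hx
    · rw [chi_apply_self, mul_one, inv_mul_cancel₀ ha]
    · rw [chi_apply_of_ne hx, mul_zero, zero_mul]
  rw [key]
  exact I.mul_mem_left _ hf

theorem stmt10 {X : Type*} [TopologicalSpace X] [T1Space X] (I : Ideal (CcF X))
    (hI : I ≠ ⊥) :
    (∀ J : Ideal (CcF X), J < I → J = ⊥) ↔ ∃ a : X, I = Ideal.span {chi X a} := by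
  constructor
  · intro hmin
    obtain ⟨f, hfI, hf⟩ := Submodule.exists_mem_ne_zero_of_ne_bot hI
    obtain ⟨a, ha⟩ := CcF.exists_apply_ne_zero hf
    have hle : Ideal.span {chi X a} ≤ I :=
      (Ideal.span_singleton_le_iff_mem I).mpr (chi_mem_of_apply_ne_zero hfI ha)
    refine ⟨a, (hle.eq_of_not_lt fun hlt => ?_).symm⟩
    exact chi_ne_zero a (Ideal.span_singleton_eq_bot.mp (hmin _ hlt))
  · rintro ⟨a, rfl⟩ J hJ
    by_contra hJ0
    obtain ⟨f, hfJ, hf⟩ := Submodule.exists_mem_ne_zero_of_ne_bot hJ0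
    obtain ⟨x, hx⟩ := CcF.exists_apply_ne_zero hf
    obtain ⟨g, rfl⟩ := Ideal.mem_span_singleton'.mp (hJ.le hfJ)
    have hxa : x = a := by
      by_contra hne
      refine hx ?_
      change (g : X → ℝ) x * (chi X a : X → ℝ) x = 0
      rw [chi_apply_of_ne hne, mul_zero]
    subst hxa
    exact hJ.not_ge
      ((Ideal.span_singleton_le_iff_mem J).mpr (chi_mem_of_apply_ne_zero hfJ hx))
end

section
/- Let J₁ = {f ∈ C_c(X)_F : for every g ∈ C_c(X)_F the set Z(1 − fg) = {x ∈ X : f(x)g(x) = 1} is finite}. Then J₁ equals the intersection of all essential maximal ideals of C_c(X)_F (where this intersection is understood to be all of C_c(X)_F if there are no essential maximal ideals). -/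
namespace CcF

variable {X : Type*} [TopologicalSpace X]

/-- On a T₁ space, the function with constant value `c` on a finite set and `0` elsewhere. -/
noncomputable def finiteIndicator [T1Space X] {S : Set X} (hS : S.Finite) (c : ℝ) : CcF X :=
  ⟨S.indicator fun _ => c, by
    refine ⟨((Set.countable_singleton c).insert 0).mono ?_, hS.subset fun x hx => ?_⟩
    · rintro - ⟨x, rfl⟩
      by_cases hx : x ∈ S <;> simp [hx]
    · by_contra hxS
      refine hx ((continuousAt_const (y := (0 : ℝ))).congr ?_)
      filter_upwards [hS.isClosed.isOpen_compl.mem_nhds hxS] with y hy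
      exact (Set.indicator_of_notMem hy _).symm⟩

theorem isUnit_of_forall_ne_zero_s13 {h : CcF X} (hh : ∀ x, h.1 x ≠ 0) : IsUnit h := by
  have hinv : (fun x => (h.1 x)⁻¹) ∈ CcF X := by
    refine ⟨(h.2.1.image fun t => t⁻¹).mono ?_, h.2.2.subset fun x hx hc => hx (hc.inv₀ (hh x))⟩
    rintro - ⟨x, rfl⟩
    exact ⟨h.1 x, Set.mem_range_self x, rfl⟩
  refine IsUnit.of_mul_eq_one (⟨_, hinv⟩ : CcF X) (Subtype.ext (funext fun x => ?_))
  exact mul_inv_cancel₀ (hh x)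

/-- The ideal of functions with only finitely many nonzero values on points of `Z`. -/
def finiteOn (Z : Set X) : Ideal (CcF X) where
  carrier := {h | {x | x ∈ Z ∧ h.1 x ≠ 0}.Finite}
  zero_mem' := Set.finite_empty.subset fun _ hx => hx.2 rfl
  add_mem' := fun {a b} ha hb => (ha.union hb).subset fun x hx => by
    by_contra hn
    simp only [Set.mem_union, Set.mem_ofPred_eq, hx.1, true_and, not_or, not_not] at hn
    refine hx.2 ?_
    change a.1 x + b.1 x = 0
    rw [hn.1, hn.2, add_zero]
  smul_mem' := fun c a ha => ha.subset fun x hx => ⟨hx.1, fun h0 => hx.2 (by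
    change c.1 x * a.1 x = 0
    rw [h0, mul_zero])⟩

variable [T1Space X] {M : Ideal (CcF X)}

theorem finiteIndicator_singleton_ne_zero (x : X) :
    finiteIndicator (Set.finite_singleton x) 1 ≠ 0 := fun h => by
  have := congrFun (congrArg Subtype.val h) x
  change ({x} : Set X).indicator (fun _ => (1 : ℝ)) x = 0 at this
  simp at this

theorem finiteIndicator_one_mem (hM : ∀ J : Ideal (CcF X), J ≠ ⊥ → M ⊓ J ≠ ⊥)
    {S : Set X} (hS : S.Finite) : finiteIndicator hS 1 ∈ M := by
  have hpt : ∀ x : X, finiteIndicator (Set.finite_singleton x) 1 ∈ M := by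
    intro x
    obtain ⟨b, ⟨hbM, hbJ⟩, hb⟩ := Submodule.exists_mem_ne_zero_of_ne_bot
      (hM (Ideal.span {finiteIndicator (Set.finite_singleton x) 1})
        (by simpa using finiteIndicator_singleton_ne_zero x))
    obtain ⟨r, rfl⟩ := Ideal.mem_span_singleton'.1 hbJ
    have hr : r.1 x ≠ 0 := by
      intro hr
      refine hb (Subtype.ext (funext fun y => ?_))
      change r.1 y * ({x} : Set X).indicator (fun _ => (1 : ℝ)) y = 0
      by_cases hy : y = x
      · rw [hy, hr, zero_mul]
      · simp [hy]
    convert M.mul_mem_left (finiteIndicator (Set.finite_singleton x) (r.1 x)⁻¹) hbM using 1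
    refine Subtype.ext (funext fun y => ?_)
    change ({x} : Set X).indicator (fun _ => (1 : ℝ)) y =
      ({x} : Set X).indicator (fun _ => (r.1 x)⁻¹) y *
        (r.1 y * ({x} : Set X).indicator (fun _ => (1 : ℝ)) y)
    by_cases hy : y = x
    · subst hy
      simp [hr]
    · simp [hy]
  induction S, hS using Set.Finite.induction_on with
  | empty =>
    convert M.zero_mem
    exact Subtype.ext (Set.indicator_empty _)
  | @insert a S ha hS ih =>
    convert M.add_mem (hpt a) ih using 1
    exact Subtype.ext (Set.indicator_union_of_disjoint (Set.disjoint_singleton_left.2 ha) _)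

theorem essential_of_finiteIndicator_mem (x₀ : X)
    (hM : ∀ x : X, finiteIndicator (Set.finite_singleton x) 1 ∈ M) :
    M ≠ ⊥ ∧ ∀ J : Ideal (CcF X), J ≠ ⊥ → M ⊓ J ≠ ⊥ := by
  refine ⟨fun h => finiteIndicator_singleton_ne_zero x₀ (by simpa [h] using hM x₀),
    fun J hJ hMJ => ?_⟩
  obtain ⟨j, hj, hj0⟩ := Submodule.exists_mem_ne_zero_of_ne_bot hJ
  refine hj0 (Subtype.ext (funext fun x => ?_))
  have hmem : finiteIndicator (Set.finite_singleton x) 1 * j ∈ M ⊓ J :=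
    ⟨M.mul_mem_right j (hM x), J.mul_mem_left _ hj⟩
  rw [hMJ, Ideal.mem_bot] at hmem
  have := congrFun (congrArg Subtype.val hmem) x
  change ({x} : Set X).indicator (fun _ => (1 : ℝ)) x * j.1 x = 0 at this
  simpa using this

end CcF

theorem stmt13 {X : Type*} [TopologicalSpace X] [T1Space X] (f : CcF X) :
    (∀ g : CcF X, {x : X | (f : X → ℝ) x * (g : X → ℝ) x = 1}.Finite) ↔
      (∀ M : Ideal (CcF X), M.IsMaximal →
        (M ≠ ⊥ ∧ ∀ J : Ideal (CcF X), J ≠ ⊥ → M ⊓ J ≠ ⊥) → f ∈ M) := by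
  constructor
  · intro hf M hM hess
    by_contra hfM
    obtain ⟨g, m, hm, hgm⟩ := hM.exists_inv hfM
    have hmx : ∀ x, m.1 x = 1 - f.1 x * g.1 x := fun x => by
      have := congrFun (congrArg Subtype.val hgm) x
      change g.1 x * f.1 x + m.1 x = 1 at this
      linarith
    have hZ : {x | m.1 x = 0}.Finite := (hf g).subset fun x hx => by
      have hx' : m.1 x = 0 := hx
      rw [hmx] at hx'
      change f.1 x * g.1 x = 1
      linarith
    have hu : m + CcF.finiteIndicator hZ 1 ∈ M :=
      M.add_mem hm (CcF.finiteIndicator_one_mem hess.2 hZ)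
    refine hM.ne_top (Ideal.eq_top_of_isUnit_mem M hu (CcF.isUnit_of_forall_ne_zero_s13 fun x => ?_))
    change m.1 x + {x | m.1 x = 0}.indicator (fun _ => (1 : ℝ)) x ≠ 0
    by_cases hx : m.1 x = 0 <;> simp [Set.indicator, hx]
  · intro h g
    by_contra hZ
    let K := CcF.finiteOn {x : X | (f : X → ℝ) x * (g : X → ℝ) x = 1}
    have hK : K ≠ ⊤ := by
      rw [Ideal.ne_top_iff_one]
      intro h1
      refine hZ (Set.Finite.subset h1 fun x hx => ⟨hx, ?_⟩)
      change (1 : ℝ) ≠ 0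
      exact one_ne_zero
    obtain ⟨M, hM, hKM⟩ := K.exists_le_maximal hK
    obtain ⟨x₀, -⟩ := Set.Infinite.nonempty hZ
    have hχ : ∀ x : X, CcF.finiteIndicator (Set.finite_singleton x) 1 ∈ M := fun x =>
      hKM ((Set.finite_singleton x).subset fun y hy => by
        by_contra hyx
        refine hy.2 ?_
        change ({x} : Set X).indicator (fun _ => (1 : ℝ)) y = 0
        exact Set.indicator_of_notMem hyx _)
    have hfg : 1 - f * g ∈ M := hKM (Set.finite_empty.subset fun y hy => hy.2 (by
      have hy1 : f.1 y * g.1 y = 1 := hy.1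
      change 1 - f.1 y * g.1 y = 0
      rw [hy1, sub_self]))
    have hfM := h M hM (CcF.essential_of_finiteIndicator_mem x₀ hχ)
    refine hM.ne_top ((Ideal.eq_top_iff_one M).2 ?_)
    simpa using M.add_mem hfg (M.mul_mem_right g hfM)
end

section
/- If f ∈ C_c(X)_F is such that for every g ∈ C_c(X)_F the set Z(1 − fg) = {x ∈ X : f(x)g(x) = 1} is finite, then COZ(f) = {x ∈ X : f(x) ≠ 0} is a countable set. -/
/-- Composing a member of `C_c(X)_F` with a continuous function stays in `C_c(X)_F`. -/
theorem comp_mem_CcF {X : Type*} [TopologicalSpace X] {φ : ℝ → ℝ} (hφ : Continuous φ)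
    {f : X → ℝ} (hf : f ∈ CcF X) : φ ∘ f ∈ CcF X := by
  refine ⟨?_, hf.2.subset fun x hx hc => hx (hφ.continuousAt.comp hc)⟩
  rw [Set.range_comp]
  exact hf.1.image φ

/-- If `1 - f g` has a finite zero set for all `g`, then `|f| ≥ ε` only at finitely many points. -/
theorem finite_setOf_le_abs {X : Type*} [TopologicalSpace X] (f : CcF X)
    (h : ∀ g : CcF X, {x : X | (f : X → ℝ) x * (g : X → ℝ) x = 1}.Finite)
    {ε : ℝ} (hε : 0 < ε) : {x : X | ε ≤ |(f : X → ℝ) x|}.Finite := by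
  have hpos (t : ℝ) : max (t ^ 2) (ε ^ 2) ≠ 0 := (lt_max_of_lt_right (by positivity)).ne'
  have hφ : Continuous fun t : ℝ => t / max (t ^ 2) (ε ^ 2) :=
    continuous_id.div ((continuous_pow 2).max continuous_const) hpos
  refine (h ⟨_, comp_mem_CcF hφ f.2⟩).subset fun x (hx : ε ≤ |(f : X → ℝ) x|) => ?_
  have hsq : ε ^ 2 ≤ (f : X → ℝ) x ^ 2 := sq_le_sq.mpr (by rwa [abs_of_pos hε])
  have hne : (f : X → ℝ) x ≠ 0 := abs_pos.mp (hε.trans_le hx)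
  simp only [Set.mem_ofPred_eq, Function.comp_apply, max_eq_left hsq]
  field_simp

theorem stmt14 {X : Type*} [TopologicalSpace X] [T1Space X] (f : CcF X)
    (h : ∀ g : CcF X, {x : X | (f : X → ℝ) x * (g : X → ℝ) x = 1}.Finite) :
    {x : X | (f : X → ℝ) x ≠ 0}.Countable := by
  refine (Set.countable_iUnion fun n : ℕ =>
    (finite_setOf_le_abs f h (Nat.one_div_pos_of_nat (n := n))).countable).mono fun x hx => ?_
  obtain ⟨n, hn⟩ := exists_nat_one_div_lt (abs_pos.mpr hx)
  exact Set.mem_iUnion.mpr ⟨n, hn.le⟩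
end

section
/- Any two disjoint subsets of X are F_c-completely separated if and only if for every subset A of X there exists a finite subset F of X such that A \ F is a clopen subset of the subspace X \ F. -/
theorem isClopen_of_eq_zero_of_eq_one {Y : Type*} [TopologicalSpace Y] {g : Y → ℝ}
    (hg : Continuous g) {A : Set Y} (h0 : ∀ y ∈ A, g y = 0) (h1 : ∀ y ∉ A, g y = 1) :
    IsClopen A := by
  have e0 : A = g ⁻¹' {0} := by
    ext y
    by_cases hy : y ∈ A
    · simp [hy, h0 y hy]
    · simp [hy, h1 y hy]
  have e1 : A = g ⁻¹' {1}ᶜ := by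
    ext y
    by_cases hy : y ∈ A
    · simp [hy, h0 y hy]
    · simp [hy, h1 y hy]
  constructor
  · rw [e0]
    exact isClosed_singleton.preimage hg
  · rw [e1]
    exact isClosed_singleton.isOpen_compl.preimage hg

theorem continuousAt_indicator_compl_of_isClopen {X : Type*} [TopologicalSpace X]
    {A U : Set X} (hU : IsOpen U) (hA : IsClopen {x : U | (x : X) ∈ A}) {x : X} (hx : x ∈ U) :
    ContinuousAt (Aᶜ.indicator (1 : X → ℝ)) x := by
  have hc : Continuous ({x : U | (x : X) ∈ A}ᶜ.indicator (1 : U → ℝ)) :=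
    continuous_one.indicator (by simp [hA.compl.frontier_eq])
  have hr : ContinuousOn (Aᶜ.indicator (1 : X → ℝ)) U := by
    rw [continuousOn_iff_continuous_domRestrict]
    exact hc
  exact hr.continuousAt (hU.mem_nhds hx)

theorem stmt16 {X : Type*} [TopologicalSpace X] [T1Space X] :
    (∀ A B : Set X, Disjoint A B → FcCompletelySeparated X A B) ↔
      (∀ A : Set X, ∃ F : Set X, F.Finite ∧
        IsClopen {x : (Fᶜ : Set X) | (x : X) ∈ A}) := by
  constructor
  · intro h A
    obtain ⟨f, h0, h1⟩ := h A Aᶜ disjoint_compl_right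
    refine ⟨{x | ¬ ContinuousAt (f : X → ℝ) x}, f.2.2, ?_⟩
    refine isClopen_of_eq_zero_of_eq_one
      (g := fun x : ({x | ¬ ContinuousAt (f : X → ℝ) x}ᶜ : Set X) => (f : X → ℝ) x) ?_
      (fun y hy => h0 y hy) (fun y hy => h1 y hy)
    rw [continuous_iff_continuousAt]
    intro x
    exact (not_not.mp x.2).comp continuous_subtype_val.continuousAt
  · intro h A B hAB
    obtain ⟨F, hF, hA⟩ := h A
    refine ⟨⟨Aᶜ.indicator 1, ?_, ?_⟩, ?_, ?_⟩
    · refine (Set.toFinite ({0, 1} : Set ℝ)).countable.mono ?_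
      rintro - ⟨x, rfl⟩
      by_cases hx : x ∈ A <;> simp [hx]
    · refine hF.subset fun x hx => ?_
      by_contra hxF
      exact hx (continuousAt_indicator_compl_of_isClopen hF.isClosed.isOpen_compl hA hxF)
    · intro a ha
      simp [ha]
    · intro b hb
      simp [hAB.notMem_of_mem_right hb]
end

section
/- Any two disjoint subsets of X are F_c-completely separated if and only if every subset A of X is of the form COZ(e) for some idempotent e ∈ C_c(X)_F (e·e = e). -/
theorem stmt17 {X : Type*} [TopologicalSpace X] [T1Space X] :
    (∀ A B : Set X, Disjoint A B → FcCompletelySeparated X A B) ↔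
      (∀ A : Set X, ∃ e : CcF X, e * e = e ∧ A = {x : X | (e : X → ℝ) x ≠ 0}) := by
  constructor
  · intro h A
    obtain ⟨e, h₀, h₁⟩ := h Aᶜ A disjoint_compl_left
    refine ⟨e, Subtype.ext (funext fun x => ?_), Set.ext fun x => ?_⟩
    · change (e : X → ℝ) x * (e : X → ℝ) x = (e : X → ℝ) x
      by_cases hx : x ∈ A
      · simp [h₁ x hx]
      · simp [h₀ x hx]
    · by_cases hx : x ∈ A
      · simp [hx, h₁ x hx]
      · simp [hx, h₀ x hx]
  · intro h A B hAB
    obtain ⟨e, he, hB⟩ := h B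
    refine ⟨e, fun a ha => ?_, fun b hb => ?_⟩
    · by_contra hne
      exact Set.disjoint_left.mp hAB ha (hB ▸ hne)
    · have hne : (e : X → ℝ) b ≠ 0 := by
        rw [hB] at hb
        exact hb
      have hmul : (e : X → ℝ) b * (e : X → ℝ) b = (e : X → ℝ) b :=
        congrFun (congrArg Subtype.val he) b
      exact (mul_eq_left₀ hne).mp hmul
end

section
/- If X is a completely regular T₁ space in which every Gδ subset is open (a P-space), then C_c(X)_F is a von Neumann regular ring: for every f ∈ C_c(X)_F there exists g ∈ C_c(X)_F with f = f²g. -/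
/-- In a space whose `Gδ` sets are open, neighborhood filters are closed under countable
intersections. -/
theorem countableInterFilter_nhds_of_isOpen_of_isGδ {X : Type*} [TopologicalSpace X]
    (hP : ∀ s : Set X, IsGδ s → IsOpen s) (x : X) : CountableInterFilter (nhds x) where
  countable_sInter_mem S hS hmem := by
    refine Filter.mem_of_superset
      ((hP _ (IsGδ.biInter_of_isOpen hS fun s _ => isOpen_interior)).mem_nhds
        (Set.mem_iInter₂.mpr fun s hs => mem_interior_iff_mem_nhds.mpr (hmem s hs)))
      (Set.subset_sInter fun s hs => (Set.biInter_subset_of_mem hs).trans interior_subset)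

/-- Along a filter closed under countable intersections, a function converging in a
first-countable `T₁` space is eventually equal to its limit. -/
theorem Filter.Tendsto.eventuallyEq_const_of_countableInterFilter {X Y : Type*}
    [TopologicalSpace Y] [T1Space Y] [FirstCountableTopology Y] {l : Filter X}
    [CountableInterFilter l] {f : X → Y} {y : Y} (hf : Filter.Tendsto f l (nhds y)) :
    f =ᶠ[l] fun _ => y := by
  obtain ⟨u, hu⟩ := (nhds y).exists_antitone_basis
  filter_upwards [eventually_countable_forall.mpr fun n => hf (hu.mem n)] with z hz
  by_contra hne
  obtain ⟨n, hn⟩ := hu.mem_iff.mp (isOpen_compl_singleton.mem_nhds (Ne.symm hne))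
  exact hn (hz n) rfl

theorem stmt18 {X : Type*} [TopologicalSpace X] [T1Space X] [CompletelyRegularSpace X]
    (hP : ∀ s : Set X, IsGδ s → IsOpen s) :
    ∀ f : CcF X, ∃ g : CcF X, f = f ^ 2 * g := by
  intro f
  have hinv : (f : X → ℝ)⁻¹ ∈ CcF X := by
    refine ⟨(f.2.1.image (·⁻¹)).mono ?_, f.2.2.subset fun x hx hf => hx ?_⟩
    · rintro - ⟨x, rfl⟩
      exact ⟨_, Set.mem_range_self x, rfl⟩
    · have := countableInterFilter_nhds_of_isOpen_of_isGδ hP x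
      exact continuousAt_const.congr
        (hf.tendsto.eventuallyEq_const_of_countableInterFilter.inv.symm)
  refine ⟨⟨_, hinv⟩, Subtype.ext (funext fun x => ?_)⟩
  change (f : X → ℝ) x = (f : X → ℝ) x ^ 2 * ((f : X → ℝ) x)⁻¹
  by_cases h : (f : X → ℝ) x = 0
  · simp [h]
  · field_simp
end

section
/- C_c(X)_F is a von Neumann regular ring (for every f ∈ C_c(X)_F there exists g ∈ C_c(X)_F with f = f²g) if and only if for every f ∈ C_c(X)_F there exists a finite subset F of X such that Z(f) \ F is a clopen subset of the subspace X \ F. -/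
/-- If `f = f ^ 2 * g` in `C_c(X)_F`, then `Z(f)` is clopen off the discontinuities of `f` and
`g`. -/
theorem CcF.isClopen_of_eq_sq_mul {X : Type*} [TopologicalSpace X] {f g : CcF X}
    (h : f = f ^ 2 * g) :
    ∃ F : Set X, F.Finite ∧ IsClopen {x : (Fᶜ : Set X) | (f : X → ℝ) x = 0} := by
  have hx : ∀ x, (f : X → ℝ) x = (f : X → ℝ) x ^ 2 * (g : X → ℝ) x := fun x =>
    congrFun (congrArg Subtype.val h) x
  refine ⟨_, f.2.2.union g.2.2, ?_⟩
  set F : Set X := {x | ¬ ContinuousAt (f : X → ℝ) x} ∪ {x | ¬ ContinuousAt (g : X → ℝ) x}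
  have hf : Continuous fun x : (Fᶜ : Set X) => (f : X → ℝ) x :=
    continuous_iff_continuousAt.mpr fun x =>
      ContinuousAt.comp (not_not.mp fun hc => x.2 (Or.inl hc)) continuous_subtype_val.continuousAt
  have hg : Continuous fun x : (Fᶜ : Set X) => (g : X → ℝ) x :=
    continuous_iff_continuousAt.mpr fun x =>
      ContinuousAt.comp (not_not.mp fun hc => x.2 (Or.inr hc)) continuous_subtype_val.continuousAt
  refine ⟨isClosed_eq hf continuous_const, ?_⟩
  have hZ : {x : (Fᶜ : Set X) | (f : X → ℝ) x = 0} =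
      {x : (Fᶜ : Set X) | (f : X → ℝ) x * (g : X → ℝ) x ≠ 1} := by
    ext x
    refine ⟨fun h0 h1 => ?_, fun h1 => by_contra fun h0 => h1 (mul_left_cancel₀ h0 ?_)⟩
    · rw [show (f : X → ℝ) x = 0 from h0, zero_mul] at h1
      exact zero_ne_one h1
    · linear_combination -hx x
  rw [hZ]
  exact isOpen_ne_fun (hf.mul hg) continuous_const

/-- If `Z(f)` is open off a finite set, then the pointwise inverse of `f` is in `C_c(X)_F`. -/
theorem CcF.inv_mem {X : Type*} [TopologicalSpace X] [T1Space X] (f : CcF X) {F : Set X}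
    (hF : F.Finite) (ho : IsOpen {x : (Fᶜ : Set X) | (f : X → ℝ) x = 0}) :
    (fun x => ((f : X → ℝ) x)⁻¹) ∈ CcF X := by
  refine ⟨(f.2.1.image fun t => t⁻¹).mono ?_, (hF.union f.2.2).subset fun x hx => ?_⟩
  · rintro - ⟨x, rfl⟩
    exact ⟨_, Set.mem_range_self x, rfl⟩
  by_contra hc
  obtain ⟨hxF, hxc⟩ := not_or.mp hc
  by_cases h0 : (f : X → ℝ) x = 0
  · have hn := (hF.isClosed.isOpen_compl.isOpenMap_subtype_val _ ho).mem_nhds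
      ⟨⟨x, hxF⟩, h0, rfl⟩
    refine hx (continuousAt_const (y := (0 : ℝ)) |>.congr ?_)
    filter_upwards [hn] with y hy
    obtain ⟨z, hz, rfl⟩ := hy
    rw [show (f : X → ℝ) z = 0 from hz, inv_zero]
  · exact hx ((not_not.mp hxc).inv₀ h0)

theorem stmt19 {X : Type*} [TopologicalSpace X] [T1Space X] :
    (∀ f : CcF X, ∃ g : CcF X, f = f ^ 2 * g) ↔
      (∀ f : CcF X, ∃ F : Set X, F.Finite ∧
        IsClopen {x : (Fᶜ : Set X) | (f : X → ℝ) x = 0}) := by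
  refine ⟨fun H f => (H f).elim fun _ h => CcF.isClopen_of_eq_sq_mul h, fun H f => ?_⟩
  obtain ⟨F, hF, hc⟩ := H f
  refine ⟨⟨_, CcF.inv_mem f hF hc.isOpen⟩, Subtype.ext (funext fun x => ?_)⟩
  change (f : X → ℝ) x = (f : X → ℝ) x ^ 2 * ((f : X → ℝ) x)⁻¹
  by_cases h0 : (f : X → ℝ) x = 0
  · simp [h0]
  · field_simp
end
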